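/- arXiv:2111.05807 — 2 statements merged into one kernel-verified Lean document; each statement's English description precedes it below -/
import Mathlib

section
/- Let G : [1,∞) → (0,∞) be differentiable and nondecreasing with G(u) → ∞ as u → ∞, and suppose there are constants c ≥ 1, C_1, C_2 > 0, δ ∈ (0,1) and a function H : [c,∞) → (0,∞) with lim_{u→∞} H(u) = 0 and liminf_{u→∞} u·H(u) > 0, such that for every u ≥ c and every x ∈ [(1−δ)u, u] one has C_1·H(u) ≤ G'(x) ≤ C_2·H(u). Set a_j = e^{G(j)} for integers j ≥ 1. Then for every p > 2 there exist a constant A > 0 and u_0 ≥ 1 such that for all integers u ≥ u_0: (Σ_{j=1}^{u} a_j^p) / (Σ_{j=1}^{u} a_j²)^{p/2} ≤ A · H(u)^{p/2 − 1}. -/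
open MeasureTheory Filter Finset Real

/-- For nonnegative reals bounded by `M`, the ratio of the `p`-th power sum to the `p / 2`-th power
of the sum of squares is controlled by the share of `M ^ 2` in the sum of squares. -/
theorem sum_rpow_div_le_of_sq_le {ι : Type*} (s : Finset ι) (a : ι → ℝ) {M t p : ℝ}
    (ha : ∀ i ∈ s, 0 < a i) (haM : ∀ i ∈ s, a i ≤ M) (hM : 0 < M) (ht : 0 ≤ t)
    (hS : 0 < ∑ i ∈ s, a i ^ 2) (hMt : M ^ 2 ≤ t * ∑ i ∈ s, a i ^ 2) (hp : 2 < p) :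
    (∑ i ∈ s, a i ^ p) / (∑ i ∈ s, a i ^ 2) ^ (p / 2) ≤ t ^ (p / 2 - 1) := by
  set S := ∑ i ∈ s, a i ^ 2
  have hnum : ∑ i ∈ s, a i ^ p ≤ M ^ (p - 2) * S := by
    rw [Finset.mul_sum]
    refine Finset.sum_le_sum fun i hi => ?_
    have hsplit : a i ^ p = a i ^ (p - 2) * a i ^ 2 := by
      rw [← Real.rpow_natCast, ← Real.rpow_add (ha i hi)]
      norm_num
    rw [hsplit]
    gcongr
    · exact (ha i hi).le
    · exact haM i hi
  have hpow : M ^ (p - 2) = (M ^ 2) ^ (p / 2 - 1) := by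
    rw [← Real.rpow_natCast, ← Real.rpow_mul hM.le]
    congr 1
    push_cast
    ring
  have hden : S ^ (p / 2) = S ^ (p / 2 - 1) * S := by
    rw [← Real.rpow_add_one hS.ne']
    norm_num
  rw [div_le_iff₀ (by positivity)]
  calc ∑ i ∈ s, a i ^ p ≤ (M ^ 2) ^ (p / 2 - 1) * S := hpow ▸ hnum
    _ ≤ (t * S) ^ (p / 2 - 1) * S := by
      gcongr
      linarith
    _ = t ^ (p / 2 - 1) * S ^ (p / 2) := by
      rw [Real.mul_rpow ht hS.le, hden, mul_assoc]

/-- If `G` grows by at most `C * h * (u - j)` on a window `[u - K / h, u]`, then the sum of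
`exp (G j) ^ 2` is at least a constant multiple of `exp (G u) ^ 2 / h`. -/
theorem exp_sq_le_mul_sum_exp_sq (G : ℝ → ℝ) {C K h : ℝ} (hC : 0 ≤ C) (hK : 0 < K) (hh : 0 < h)
    (u : ℕ) (hu : 1 ≤ u - K / h)
    (hG : ∀ j : ℝ, u - K / h ≤ j → j ≤ u → G u - G j ≤ C * h * (u - j)) :
    Real.exp (G u) ^ 2 ≤
      Real.exp (2 * C * K) / K * h * ∑ j ∈ Finset.Icc 1 u, Real.exp (G j) ^ 2 := by
  set m := ⌊K / h⌋₊
  have hm : (m : ℝ) ≤ K / h := Nat.floor_le (by positivity)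
  have hm' : K / h ≤ m + 1 := (Nat.lt_floor_add_one _).le
  have hmu : m + 1 ≤ u := by
    have : (m : ℝ) + 1 ≤ u := by linarith
    exact_mod_cast this
  have hterm : ∀ j ∈ Finset.Icc (u - m) u,
      Real.exp (G u) ^ 2 * Real.exp (-(2 * C * K)) ≤ Real.exp (G j) ^ 2 := by
    intro j hj
    rw [Finset.mem_Icc] at hj
    have h1 : (u : ℝ) ≤ j + m := by
      have : u ≤ j + m := by omega
      exact_mod_cast this
    have h2 : (j : ℝ) ≤ u := by exact_mod_cast hj.2
    have h3 := hG j (by linarith) h2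
    have h4 : C * h * (u - j) ≤ C * K := by
      calc C * h * (u - j) ≤ C * h * (K / h) := by gcongr; linarith
        _ = C * K := by field_simp
    rw [← Real.exp_nat_mul, ← Real.exp_nat_mul, ← Real.exp_add]
    apply Real.exp_le_exp.2
    push_cast
    linarith
  have hsum : ((m : ℝ) + 1) * (Real.exp (G u) ^ 2 * Real.exp (-(2 * C * K))) ≤
      ∑ j ∈ Finset.Icc 1 u, Real.exp (G j) ^ 2 := by
    have hcard : (Finset.Icc (u - m) u).card = m + 1 := by
      rw [Nat.card_Icc]
      omega
    calc _ = (Finset.Icc (u - m) u).card • (Real.exp (G u) ^ 2 * Real.exp (-(2 * C * K))) := by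
          rw [hcard, nsmul_eq_mul]
          push_cast
          rfl
      _ ≤ ∑ j ∈ Finset.Icc (u - m) u, Real.exp (G j) ^ 2 :=
          Finset.card_nsmul_le_sum _ _ _ hterm
      _ ≤ _ := Finset.sum_le_sum_of_subset_of_nonneg
          (Finset.Icc_subset_Icc (by omega) le_rfl) fun _ _ _ => by positivity
  calc Real.exp (G u) ^ 2 = Real.exp (2 * C * K) / K * h *
        (K / h * (Real.exp (G u) ^ 2 * Real.exp (-(2 * C * K)))) := by
        rw [Real.exp_neg]
        field_simp
    _ ≤ _ := by
        refine mul_le_mul_of_nonneg_left (le_trans ?_ hsum) (by positivity)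
        gcongr

theorem stmt12 (G H : ℝ → ℝ) (c : ℝ) (C₁ C₂ δ : ℝ)
    (hc : 1 ≤ c) (hC₁ : 0 < C₁) (hC₂ : 0 < C₂) (hδ : 0 < δ ∧ δ < 1)
    (hGpos : ∀ x : ℝ, 1 ≤ x → 0 < G x)
    (hGdiff : ∀ x : ℝ, 1 ≤ x → DifferentiableAt ℝ G x)
    (hGmono : MonotoneOn G (Set.Ici (1 : ℝ)))
    (hGtop : Tendsto G atTop atTop)
    (hHpos : ∀ u : ℝ, c ≤ u → 0 < H u)
    (hHzero : Tendsto H atTop (nhds 0))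
    (hHliminf : ∃ b : ℝ, 0 < b ∧ ∀ᶠ u in atTop, b ≤ u * H u)
    (hcomp : ∀ u : ℝ, c ≤ u → ∀ x ∈ Set.Icc ((1 - δ) * u) u, 1 ≤ x →
      C₁ * H u ≤ deriv G x ∧ deriv G x ≤ C₂ * H u) :
    ∀ p : ℝ, 2 < p → ∃ A : ℝ, 0 < A ∧ ∃ u₀ : ℕ, 1 ≤ u₀ ∧ ∀ u : ℕ, u₀ ≤ u →
      (∑ j ∈ Finset.Icc 1 u, Real.exp (G j) ^ p) /
          (∑ j ∈ Finset.Icc 1 u, Real.exp (G j) ^ 2) ^ (p / 2) ≤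
        A * H u ^ (p / 2 - 1) := by
  intro p hp
  obtain ⟨b, hb, hbH⟩ := hHliminf
  obtain ⟨hδ₀, hδ₁⟩ := hδ
  have hbδ : 0 < b * δ := mul_pos hb hδ₀
  set B := Real.exp (2 * C₂ * (b * δ)) / (b * δ)
  have hev : ∀ᶠ u : ℕ in atTop, b ≤ (u : ℝ) * H u ∧ c ≤ (u : ℝ) ∧ 1 / (1 - δ) ≤ (u : ℝ) :=
    tendsto_natCast_atTop_atTop.eventually
      (hbH.and ((eventually_ge_atTop c).and (eventually_ge_atTop _)))
  obtain ⟨N, hN⟩ := eventually_atTop.1 hev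
  refine ⟨B ^ (p / 2 - 1), by positivity, max N 1, le_max_right _ _, fun u hu => ?_⟩
  obtain ⟨hbu, hcu, hδu⟩ := hN u (le_trans (le_max_left _ _) hu)
  have hu1 : 1 ≤ u := le_trans (le_max_right _ _) hu
  have hH : 0 < H u := hHpos u hcu
  have hwin : b * δ / H u ≤ δ * u := by
    rw [div_le_iff₀ hH]
    nlinarith
  have hlow : 1 ≤ (1 - δ) * u := by
    rwa [div_le_iff₀' (by linarith)] at hδu
  have hgrowth : ∀ j : ℝ, u - b * δ / H u ≤ j → j ≤ u → G u - G j ≤ C₂ * H u * (u - j) := by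
    intro j hj hju
    have hj' : (1 - δ) * u ≤ j := by linarith
    refine (convex_Icc j (u : ℝ)).image_sub_le_mul_sub_of_deriv_le
      (fun x hx => (hGdiff x (by linarith [hx.1])).continuousAt.continuousWithinAt)
      (fun x hx => ?_) (fun x hx => ?_) j (Set.left_mem_Icc.2 hju) u
      (Set.right_mem_Icc.2 hju) hju
    · have hx' := interior_subset hx
      exact (hGdiff x (by linarith [hx'.1])).differentiableWithinAt
    · have hx' := interior_subset hx
      exact (hcomp u hcu x ⟨hj'.trans hx'.1, hx'.2⟩ (by linarith [hx'.1])).2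
  have hsq := exp_sq_le_mul_sum_exp_sq G hC₂.le hbδ hH u (by linarith) hgrowth
  rw [← Real.mul_rpow (by positivity) hH.le]
  refine sum_rpow_div_le_of_sq_le _ _ (fun _ _ => Real.exp_pos _) (fun j hj => ?_)
    (Real.exp_pos (G u)) (by positivity)
    (Finset.sum_pos (fun _ _ => by positivity) ⟨1, by simpa using hu1⟩) hsq hp
  rw [Finset.mem_Icc] at hj
  exact Real.exp_le_exp.2 (hGmono (Set.mem_Ici.2 (by exact_mod_cast hj.1))
    (Set.mem_Ici.2 (by exact_mod_cast hu1)) (by exact_mod_cast hj.2))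
end

section
/- Let G : [1,∞) → (0,∞) be differentiable and nondecreasing with G(u) → ∞ as u → ∞, and suppose there are constants c ≥ 1, C_1, C_2 > 0, δ ∈ (0,1) and a function H : [c,∞) → (0,∞) with lim_{u→∞} H(u) = 0 and liminf_{u→∞} u·H(u) > 0, such that for every u ≥ c and every x ∈ [(1−δ)u, u] one has C_1·H(u) ≤ G'(x) ≤ C_2·H(u). Then for every r > 0 there exist constants 0 < c_r ≤ C_r and u_0 ≥ 1 such that for all integers u ≥ u_0: c_r · e^{r·G(u)} / H(u) ≤ Σ_{j=1}^{u} e^{r·G(j)} ≤ C_r · e^{r·G(u)} / H(u). -/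
open MeasureTheory Filter Finset Real

/-- A geometric sum is at most `(1 + s) / s` times its last term. -/
lemma sum_exp_mul_le {s : ℝ} (hs : 0 < s) (n : ℕ) :
    ∑ j ∈ Finset.Icc 1 n, Real.exp (s * j) ≤ Real.exp (s * n) * ((1 + s) / s) := by
  induction n with
  | zero => simp; positivity
  | succ n ih =>
    rw [Finset.sum_Icc_succ_top (by omega)]
    have hstep : Real.exp (s * n) * ((1 + s) / s) ≤ Real.exp (s * (n + 1 : ℕ)) * (1 / s) := by
      have hexp : Real.exp (s * (n + 1 : ℕ)) = Real.exp (s * n) * Real.exp s := by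
        rw [← Real.exp_add]; push_cast; ring_nf
      rw [hexp, mul_assoc, mul_one_div]
      gcongr
      linarith [Real.add_one_le_exp s]
    have hsplit : (1 + s) / s = 1 / s + 1 := by field_simp
    rw [hsplit] at ih hstep ⊢
    linarith

/-- Two-sided derivative bounds on `[x, u]` give two-sided bounds on the increment. -/
lemma increment_bounds_of_deriv_bounds {G : ℝ → ℝ} {A B x u : ℝ} (hxu : x ≤ u)
    (hdiff : ∀ y ∈ Set.Icc x u, DifferentiableAt ℝ G y)
    (hderiv : ∀ y ∈ Set.Icc x u, A ≤ deriv G y ∧ deriv G y ≤ B) :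
    A * (u - x) ≤ G u - G x ∧ G u - G x ≤ B * (u - x) := by
  have hcont : ContinuousOn G (Set.Icc x u) :=
    fun y hy => (hdiff y hy).continuousAt.continuousWithinAt
  have hdiffOn : DifferentiableOn ℝ G (interior (Set.Icc x u)) :=
    fun y hy => (hdiff y (interior_subset hy)).differentiableWithinAt
  exact ⟨(convex_Icc x u).mul_sub_le_image_sub_of_le_deriv hcont hdiffOn
      (fun y hy => (hderiv y (interior_subset hy)).1) x ⟨le_rfl, hxu⟩ u ⟨hxu, le_rfl⟩ hxu,
    (convex_Icc x u).image_sub_le_mul_sub_of_deriv_le hcont hdiffOn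
      (fun y hy => (hderiv y (interior_subset hy)).2) x ⟨le_rfl, hxu⟩ u ⟨hxu, le_rfl⟩ hxu⟩

/-- If `G` loses at least `A * (u - j)` between `u` and every `j ≤ u`, the exponential sum is
dominated by a geometric one. -/
lemma sum_exp_le_of_linear_increment {G : ℝ → ℝ} {A r : ℝ} {u : ℕ} (hA : 0 < A) (hr : 0 < r)
    (hinc : ∀ j ∈ Finset.Icc 1 u, A * ((u : ℝ) - j) ≤ G u - G j) :
    ∑ j ∈ Finset.Icc 1 u, Real.exp (r * G j) ≤
      Real.exp (r * G u) * ((1 + r * A) / (r * A)) := by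
  calc ∑ j ∈ Finset.Icc 1 u, Real.exp (r * G j)
      ≤ ∑ j ∈ Finset.Icc 1 u, Real.exp (r * G u - r * A * u) * Real.exp (r * A * j) := by
        refine Finset.sum_le_sum fun j hj => ?_
        rw [← Real.exp_add]
        apply Real.exp_le_exp.mpr
        nlinarith [mul_le_mul_of_nonneg_left (hinc j hj) hr.le]
    _ = Real.exp (r * G u - r * A * u) * ∑ j ∈ Finset.Icc 1 u, Real.exp (r * A * j) := by
        rw [Finset.mul_sum]
    _ ≤ Real.exp (r * G u - r * A * u) *
          (Real.exp (r * A * u) * ((1 + r * A) / (r * A))) := by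
        gcongr
        exact sum_exp_mul_le (mul_pos hr hA) u
    _ = Real.exp (r * G u) * ((1 + r * A) / (r * A)) := by
        rw [← mul_assoc, ← Real.exp_add]
        ring_nf

/-- If `G` varies by at most `K` on the last `L` integers up to `u`, the exponential sum is at
least `L` times `exp (r * (G u - K))`. -/
lemma mul_exp_le_sum_exp {G : ℝ → ℝ} {K L r : ℝ} {u : ℕ} (hr : 0 < r) (hL : 0 ≤ L)
    (hLu : L + 1 ≤ u)
    (hinc : ∀ j : ℕ, j ≤ u → (u : ℝ) - j ≤ L → G u - G j ≤ K) :
    L * Real.exp (r * (G u - K)) ≤ ∑ j ∈ Finset.Icc 1 u, Real.exp (r * G j) := by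
  have hfloor : (⌊L⌋₊ : ℝ) ≤ L := Nat.floor_le hL
  have hlt : ⌊L⌋₊ + 1 ≤ u := by
    have : ((⌊L⌋₊ + 1 : ℕ) : ℝ) ≤ u := by push_cast; linarith
    exact_mod_cast this
  have hcard : L ≤ ((Finset.Icc (u - ⌊L⌋₊) u).card : ℝ) := by
    have : (Finset.Icc (u - ⌊L⌋₊) u).card = ⌊L⌋₊ + 1 := by
      rw [Nat.card_Icc]; omega
    rw [this]
    push_cast
    exact (Nat.lt_floor_add_one L).le
  calc L * Real.exp (r * (G u - K))
      ≤ (Finset.Icc (u - ⌊L⌋₊) u).card * Real.exp (r * (G u - K)) := by gcongr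
    _ = ∑ j ∈ Finset.Icc (u - ⌊L⌋₊) u, Real.exp (r * (G u - K)) := by
        rw [Finset.sum_const, nsmul_eq_mul]
    _ ≤ ∑ j ∈ Finset.Icc (u - ⌊L⌋₊) u, Real.exp (r * G j) := by
        refine Finset.sum_le_sum fun j hj => ?_
        rw [Finset.mem_Icc] at hj
        have hj' : (u : ℝ) ≤ j + ⌊L⌋₊ := by
          have : u ≤ j + ⌊L⌋₊ := by omega
          exact_mod_cast this
        gcongr
        linarith [hinc j hj.2 (by linarith)]
    _ ≤ ∑ j ∈ Finset.Icc 1 u, Real.exp (r * G j) := by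
        refine Finset.sum_le_sum_of_subset_of_nonneg
          (Finset.Icc_subset_Icc (by omega) le_rfl) fun _ _ _ => (Real.exp_pos _).le

theorem stmt13 (G H : ℝ → ℝ) (c : ℝ) (C₁ C₂ δ : ℝ)
    (hc : 1 ≤ c) (hC₁ : 0 < C₁) (hC₂ : 0 < C₂) (hδ : 0 < δ ∧ δ < 1)
    (hGpos : ∀ x : ℝ, 1 ≤ x → 0 < G x)
    (hGdiff : ∀ x : ℝ, 1 ≤ x → DifferentiableAt ℝ G x)
    (hGmono : MonotoneOn G (Set.Ici (1 : ℝ)))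
    (hGtop : Tendsto G atTop atTop)
    (hHpos : ∀ u : ℝ, c ≤ u → 0 < H u)
    (hHzero : Tendsto H atTop (nhds 0))
    (hHliminf : ∃ b : ℝ, 0 < b ∧ ∀ᶠ u in atTop, b ≤ u * H u)
    (hcomp : ∀ u : ℝ, c ≤ u → ∀ x ∈ Set.Icc ((1 - δ) * u) u, 1 ≤ x →
      C₁ * H u ≤ deriv G x ∧ deriv G x ≤ C₂ * H u) :
    ∀ r : ℝ, 0 < r → ∃ cr Cr : ℝ, 0 < cr ∧ cr ≤ Cr ∧ ∃ u₀ : ℕ, 1 ≤ u₀ ∧ ∀ u : ℕ, u₀ ≤ u →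
      cr * Real.exp (r * G u) / H u ≤ ∑ j ∈ Finset.Icc 1 u, Real.exp (r * G j) ∧
        ∑ j ∈ Finset.Icc 1 u, Real.exp (r * G j) ≤ Cr * Real.exp (r * G u) / H u := by
  intro r hr
  obtain ⟨b, hb, hbH⟩ := hHliminf
  obtain ⟨hδ0, hδ1⟩ := hδ
  have hlarge : ∀ᶠ u : ℝ in atTop, c ≤ u ∧ H u ≤ 1 ∧ b ≤ u * H u ∧ 1 ≤ (1 - δ) * u := by
    filter_upwards [eventually_ge_atTop c, hHzero.eventually_le_const zero_lt_one, hbH,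
      (tendsto_id.const_mul_atTop (sub_pos.mpr hδ1)).eventually_ge_atTop 1]
      with u h1 h2 h3 h4 using ⟨h1, h2, h3, h4⟩
  obtain ⟨N, hN⟩ := eventually_atTop.mp (tendsto_natCast_atTop_atTop.eventually hlarge)
  have hmin : 0 < min (δ * b) 1 := lt_min (mul_pos hδ0 hb) one_pos
  have hD : 0 < r * (C₁ * δ) := by positivity
  refine ⟨min (δ * b) 1 * Real.exp (-(r * C₂)),
    max (min (δ * b) 1 * Real.exp (-(r * C₂))) ((1 + r * (C₁ * δ)) / (r * (C₁ * δ))),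
    mul_pos hmin (Real.exp_pos _), le_max_left _ _, max N 1, le_max_right _ _, fun u hu => ?_⟩
  obtain ⟨hcu, hH1, hbu, hwin⟩ := hN u (le_of_max_le_left hu)
  have hH := hHpos u hcu
  have hu0 : (0 : ℝ) < u := by linarith
  have hinc : ∀ x : ℝ, (1 - δ) * u ≤ x → x ≤ u →
      C₁ * H u * (u - x) ≤ G u - G x ∧ G u - G x ≤ C₂ * H u * (u - x) := fun x hx hxu =>
    increment_bounds_of_deriv_bounds hxu (fun y hy => hGdiff y (by linarith [hy.1]))
      fun y hy => hcomp u hcu y ⟨hx.trans hy.1, hy.2⟩ (by linarith [hy.1])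
  constructor
  · have hLpos : 0 ≤ min (δ * b) 1 / H u := by positivity
    have hLδ : min (δ * b) 1 / H u ≤ δ * u := by
      rw [div_le_iff₀ hH]
      calc min (δ * b) 1 ≤ δ * b := min_le_left _ _
        _ ≤ δ * (u * H u) := by gcongr
        _ = δ * u * H u := by ring
    have hLH : H u * (min (δ * b) 1 / H u) ≤ 1 := by
      rw [mul_div_cancel₀ _ hH.ne']
      exact min_le_right _ _
    have hsum := mul_exp_le_sum_exp (G := G) (K := C₂) (u := u) hr hLpos (by linarith)
      fun j hj hjL => by
        have hju : (j : ℝ) ≤ u := by exact_mod_cast hj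
        calc G u - G j ≤ C₂ * H u * (u - j) := (hinc j (by linarith) hju).2
          _ = C₂ * (H u * (u - j)) := by ring
          _ ≤ C₂ * (H u * (min (δ * b) 1 / H u)) := by gcongr
          _ ≤ C₂ * 1 := by gcongr
          _ = C₂ := mul_one _
    refine le_of_eq_of_le ?_ hsum
    rw [show r * (G u - C₂) = -(r * C₂) + r * G u by ring, Real.exp_add]
    ring
  · have hlin : ∀ j ∈ Finset.Icc 1 u, C₁ * H u * δ * ((u : ℝ) - j) ≤ G u - G j := by
      intro j hj
      rw [Finset.mem_Icc] at hj
      have hj1 : (1 : ℝ) ≤ j := by exact_mod_cast hj.1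
      have hju : (j : ℝ) ≤ u := by exact_mod_cast hj.2
      have hCH : 0 < C₁ * H u := mul_pos hC₁ hH
      rcases le_total ((1 - δ) * u) j with h | h
      · calc C₁ * H u * δ * ((u : ℝ) - j) ≤ C₁ * H u * 1 * (u - j) := by
              have := sub_nonneg.mpr hju
              gcongr
          _ = C₁ * H u * (u - j) := by ring
          _ ≤ G u - G j := (hinc j h hju).1
      · have hmono : G j ≤ G ((1 - δ) * u) := hGmono hj1 hwin h
        have hwindow := (hinc ((1 - δ) * u) le_rfl (by nlinarith)).1
        calc C₁ * H u * δ * ((u : ℝ) - j) ≤ C₁ * H u * δ * u := by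
              gcongr
              linarith
          _ = C₁ * H u * (u - (1 - δ) * u) := by ring
          _ ≤ G u - G j := by linarith
    calc ∑ j ∈ Finset.Icc 1 u, Real.exp (r * G j)
        ≤ Real.exp (r * G u) *
            ((1 + r * (C₁ * H u * δ)) / (r * (C₁ * H u * δ))) :=
          sum_exp_le_of_linear_increment (by positivity) hr hlin
      _ ≤ Real.exp (r * G u) * ((1 + r * (C₁ * 1 * δ)) / (r * (C₁ * H u * δ))) := by gcongr
      _ = (1 + r * (C₁ * δ)) / (r * (C₁ * δ)) * Real.exp (r * G u) / H u := by
          field_simp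
      _ ≤ _ := by
          gcongr
          exact le_max_right _ _
end
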